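/- arXiv:1212.5481 — 2 statements merged into one kernel-verified Lean document; each statement's English description precedes it below -/
import Mathlib

section
/- Fix t₀ ∈ ℝ and a Banach space X. Let ψ₁, ψ₂ ∈ K∞ and V : X → [0,∞) be continuous with ψ₁(‖x‖) ≤ V(x) ≤ ψ₂(‖x‖) for all x ∈ X. Let ψ be positive definite with ∫_1^∞ ds/ψ(s) = ∞, let α be positive definite, χ ∈ K∞, and θ > 0 satisfy ∫_{α(a)}^a ds/ψ(s) ≥ θ for every a > 0. Then there exist ξ ∈ K∞ and γ of class K, independent of the impulse time sequence, such that for every impulse time sequence T ∈ S̃_θ, every u ≥ 0 and every x : [t₀,∞) → X for which y := V∘x is a (T,u)-Lyapunov trajectory for (ω, α, χ) with ω(s) = ψ(s), one has ‖x(t)‖ ≤ ξ(‖x(t₀)‖) + γ(u) for all t ≥ t₀ (uniform global stability over S̃_θ). -/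
open Set Filter Topology intervalIntegral

/-- A class `K` function: continuous, strictly increasing on `[0,∞)` with `γ(0) = 0`. -/
def ClassK (γ : ℝ → ℝ) : Prop :=
  ContinuousOn γ (Set.Ici 0) ∧ StrictMonoOn γ (Set.Ici 0) ∧ γ 0 = 0

/-- A class `K∞` function: class `K` and unbounded. -/
def ClassKinf (γ : ℝ → ℝ) : Prop :=
  ClassK γ ∧ Filter.Tendsto γ Filter.atTop Filter.atTop

/-- A positive definite function. -/
def PosDef (φ : ℝ → ℝ) : Prop :=
  ContinuousOn φ (Set.Ici 0) ∧ φ 0 = 0 ∧ ∀ s > (0:ℝ), 0 < φ s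

/-- A class `L` function. -/
def ClassL (g : ℝ → ℝ) : Prop :=
  ContinuousOn g (Set.Ici 0) ∧ StrictAntiOn g (Set.Ici 0) ∧
    Filter.Tendsto g Filter.atTop (nhds 0)

/-- A class `KL` function. -/
def ClassKL (β : ℝ → ℝ → ℝ) : Prop :=
  ContinuousOn (fun p : ℝ × ℝ => β p.1 p.2) (Set.Ici 0 ×ˢ Set.Ici 0) ∧
  (∀ t ≥ (0:ℝ), ClassK fun r => β r t) ∧
  (∀ r > (0:ℝ), ClassL fun t => β r t)

/-- An impulse time sequence: strictly increasing, starting after `t0` and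
tending to infinity (no finite accumulation points). -/
def ImpulseSeq (t0 : ℝ) (T : ℕ → ℝ) : Prop :=
  StrictMono T ∧ t0 < T 0 ∧ Filter.Tendsto T Filter.atTop Filter.atTop

/-- `y : [t0,∞) → [0,∞)` is a `(T,u)`-Lyapunov trajectory for `(ω, α, χ)`, with
left limits `ym i` at the impulse times `T i`: it is piecewise continuous
(right-continuous at impulse times), differentiable off `T` with
`y' ≤ ω(y)` whenever `y ≥ χ(u)`, and satisfies the jump estimate
`y(T i) ≤ max (α (ym i)) (χ u)`. -/
def LyapTraj (t0 : ℝ) (T : ℕ → ℝ) (u : ℝ) (ω α χ : ℝ → ℝ)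
    (y : ℝ → ℝ) (ym : ℕ → ℝ) : Prop :=
  (∀ t ≥ t0, 0 ≤ y t) ∧
  ContinuousOn y (Set.Ico t0 (T 0)) ∧
  (∀ i, ContinuousOn y (Set.Ico (T i) (T (i+1)))) ∧
  (∀ i, Filter.Tendsto y (nhdsWithin (T i) (Set.Iio (T i))) (nhds (ym i))) ∧
  (∀ t ≥ t0, (∀ i, t ≠ T i) → DifferentiableAt ℝ y t) ∧
  (∀ t ≥ t0, (∀ i, t ≠ T i) → χ u ≤ y t → deriv y t ≤ ω (y t)) ∧
  (∀ i, y (T i) ≤ max (α (ym i)) (χ u))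

/-- A strictly increasing bijection of `[0,∞)` is a class `K∞` function. -/
lemma classKinf_of_strictMonoOn_of_surjOn {f : ℝ → ℝ} (hf : StrictMonoOn f (Ici 0))
    (h0 : f 0 = 0) (hsurj : SurjOn f (Ici 0) (Ici 0)) : ClassKinf f := by
  have hnn : ∀ x, 0 ≤ x → 0 ≤ f x := fun x hx =>
    h0 ▸ hf.monotoneOn self_mem_Ici (mem_Ici.2 hx) hx
  refine ⟨⟨?_, hf, h0⟩, ?_⟩
  · have hmono : Monotone (fun x => if x < 0 then x else f x) := by
      intro x z hxz
      by_cases hx : x < 0 <;> by_cases hz : z < 0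
      · simpa [hx, hz] using hxz
      · simpa [hx, hz] using hx.le.trans (hnn z (not_lt.1 hz))
      · exact absurd (hxz.trans_lt hz) hx
      · simpa [hx, hz] using hf.monotoneOn (mem_Ici.2 (not_lt.1 hx)) (mem_Ici.2 (not_lt.1 hz)) hxz
    have hs : Function.Surjective (fun x => if x < 0 then x else f x) := by
      intro z
      by_cases hz : z < 0
      · exact ⟨z, by simp [hz]⟩
      · obtain ⟨x, hx, rfl⟩ := hsurj (mem_Ici.2 (not_lt.1 hz))
        exact ⟨x, by simp [not_lt.2 (mem_Ici.1 hx)]⟩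
    refine (hmono.continuous_of_surjective hs).continuousOn.congr fun x hx => ?_
    simp [not_lt.2 (mem_Ici.1 hx)]
  · refine tendsto_atTop_atTop.2 fun b => ?_
    obtain ⟨x, hx, hxb⟩ := hsurj (mem_Ici.2 (le_max_right b 0))
    refine ⟨x, fun a ha => (le_max_left b 0).trans ?_⟩
    rw [← hxb]
    exact hf.monotoneOn hx (mem_Ici.2 (le_trans (mem_Ici.1 hx) ha)) ha

lemma ClassK.nonneg {f : ℝ → ℝ} (hf : ClassK f) {x : ℝ} (hx : 0 ≤ x) : 0 ≤ f x :=
  hf.2.2 ▸ hf.2.1.monotoneOn self_mem_Ici (mem_Ici.2 hx) hx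

lemma ClassKinf.surjOn {f : ℝ → ℝ} (hf : ClassKinf f) : SurjOn f (Ici 0) (Ici 0) := by
  intro z hz
  obtain ⟨b, hb, hb0⟩ := ((hf.2.eventually_ge_atTop z).and (eventually_ge_atTop 0)).exists
  obtain ⟨x, hx, hxz⟩ := intermediate_value_Icc hb0 (hf.1.1.mono Icc_subset_Ici_self)
    ⟨hf.1.2.2.le.trans hz, hb⟩
  exact ⟨x, hx.1, hxz⟩

lemma ClassKinf.comp {f g : ℝ → ℝ} (hf : ClassKinf f) (hg : ClassKinf g) :
    ClassKinf (f ∘ g) :=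
  have hmaps : MapsTo g (Ici 0) (Ici 0) := fun _ hx => hg.1.nonneg hx
  classKinf_of_strictMonoOn_of_surjOn (hf.1.2.1.comp hg.1.2.1 hmaps)
    (by simp [hg.1.2.2, hf.1.2.2]) (hf.surjOn.comp hg.surjOn)

/-- A class `K∞` function has a class `K∞` left inverse on `[0,∞)`. -/
lemma ClassKinf.exists_inverse {f : ℝ → ℝ} (hf : ClassKinf f) :
    ∃ g, ClassKinf g ∧ ∀ x, 0 ≤ x → g (f x) = x := by
  have hleft : LeftInvOn (Function.invFunOn f (Ici 0)) f (Ici 0) :=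
    hf.1.2.1.injOn.leftInvOn_invFunOn
  refine ⟨Function.invFunOn f (Ici 0), classKinf_of_strictMonoOn_of_surjOn ?_ ?_ ?_,
    fun x hx => hleft hx⟩
  · intro a ha b hb hab
    obtain ⟨x, hx, rfl⟩ := hf.surjOn ha
    obtain ⟨z, hz, rfl⟩ := hf.surjOn hb
    rw [hleft hx, hleft hz]
    exact (hf.1.2.1.lt_iff_lt hx hz).1 hab
  · simpa [hf.1.2.2] using hleft (self_mem_Ici (a := (0:ℝ)))
  · exact fun x hx => ⟨f x, hf.1.nonneg hx, hleft hx⟩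

/-- Subadditivity of monotone functions with respect to the maximum. -/
lemma ClassKinf.map_max_le_add {f : ℝ → ℝ} (hf : ClassKinf f) {a b : ℝ}
    (ha : 0 ≤ a) (hb : 0 ≤ b) : f (max a b) ≤ f a + f b := by
  rcases max_choice a b with h | h <;> rw [h]
  · linarith [hf.1.nonneg hb]
  · linarith [hf.1.nonneg ha]

lemma PosDef.intervalIntegrable_inv {ψ : ℝ → ℝ} (hψ : PosDef ψ) {a b : ℝ} (ha : 0 < a)
    (hb : 0 < b) : IntervalIntegrable (fun s => 1 / ψ s) MeasureTheory.volume a b := by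
  have hpos : ∀ s ∈ uIcc a b, 0 < s := fun s hs => (lt_min ha hb).trans_le hs.1
  exact (continuousOn_const.div (hψ.1.mono fun s hs => (hpos s hs).le)
    fun s hs => (hψ.2.2 s (hpos s hs)).ne').intervalIntegrable

lemma PosDef.hasDerivAt_integral_inv {ψ : ℝ → ℝ} (hψ : PosDef ψ) {b : ℝ} (hb : 0 < b) :
    HasDerivAt (fun b => ∫ s in (1:ℝ)..b, 1 / ψ s) (1 / ψ b) b := by
  have hcont : ContinuousOn (fun s => 1 / ψ s) (Ioi 0) :=
    continuousOn_const.div (hψ.1.mono Ioi_subset_Ici_self) fun s hs => (hψ.2.2 s hs).ne'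
  exact integral_hasDerivAt_right (hψ.intervalIntegrable_inv one_pos hb)
    (hcont.stronglyMeasurableAtFilter isOpen_Ioi b hb)
    (hcont.continuousAt (Ioi_mem_nhds hb))

/-- Comparison estimate: if `y' ≤ ψ(y)` wherever `y ≥ M` and `F' = 1/ψ`, then `F ∘ y` exceeds
`F M` by at most the elapsed time. -/
lemma le_of_deriv_le_of_antideriv {ψ F y : ℝ → ℝ} {a b M N θ : ℝ} (hψ : ∀ s > (0:ℝ), 0 < ψ s)
    (hF : ∀ s > (0:ℝ), HasDerivAt F (1 / ψ s) s) (hmono : StrictMonoOn F (Ioi 0))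
    (hM : 0 < M) (hN : 0 < N) (hFN : F N = F M + θ) (hθ : 0 ≤ θ) (hab : b - a ≤ θ)
    (hy : ContinuousOn y (Ico a b)) (hd : ∀ t ∈ Ioo a b, DifferentiableAt ℝ y t)
    (hle : ∀ t ∈ Ioo a b, M ≤ y t → deriv y t ≤ ψ (y t)) (ha : y a ≤ M) :
    ∀ t ∈ Ico a b, y t ≤ N := by
  intro t ht
  have hMN : M ≤ N := (hmono.le_iff_le hM hN).1 (by linarith)
  by_contra! hlt
  have hsub : Icc a t ⊆ Ico a b := fun s hs => ⟨hs.1, hs.2.trans_lt ht.2⟩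
  obtain ⟨s, ⟨hs, hsM⟩, hmax⟩ :
      ∃ s, IsGreatest (Icc a t ∩ y ⁻¹' Iic M) s :=
    (isCompact_Icc.of_isClosed_subset
      ((hy.mono hsub).preimage_isClosed_of_isClosed isClosed_Icc isClosed_Iic)
      inter_subset_left).exists_isGreatest ⟨a, left_mem_Icc.2 ht.1, ha⟩
  have hst : s < t := hs.2.lt_of_ne fun h => by
    rw [h] at hsM
    exact absurd (hMN.trans_lt hlt) (not_lt.2 hsM)
  have habove : ∀ r ∈ Ioc s t, M < y r := fun r hr => by
    by_contra! h
    exact absurd (hmax ⟨⟨hs.1.trans hr.1.le, hr.2⟩, h⟩) (not_le.2 hr.1)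
  have hpos : ∀ r, 0 < max (y r) M := fun r => hM.trans_le (le_max_right _ _)
  have hcont : ContinuousOn (fun r => F (max (y r) M)) (Icc s t) := by
    intro r hr
    have hyr : ContinuousWithinAt y (Icc s t) r :=
      (hy.mono ((Icc_subset_Icc_left hs.1).trans hsub)) r hr
    exact (hF _ (hpos r)).continuousAt.comp_continuousWithinAt (f := fun r => max (y r) M)
      (hyr.max continuousWithinAt_const)
  have hderiv : ∀ r ∈ Ioo s t,
      HasDerivAt (fun r => F (max (y r) M)) (1 / ψ (y r) * deriv y r) r := by
    intro r hr
    have hrI : r ∈ Ioo a b := ⟨hs.1.trans_lt hr.1, hr.2.trans ht.2⟩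
    have hMr := habove r ⟨hr.1, hr.2.le⟩
    refine ((hF _ (hM.trans hMr)).comp r (hd r hrI).hasDerivAt).congr_of_eventuallyEq ?_
    filter_upwards [(hd r hrI).continuousAt.eventually (lt_mem_nhds hMr)] with q hq
    simp [max_eq_left hq.le]
  obtain ⟨r, hr, hreq⟩ := exists_hasDerivAt_eq_slope _ _ hst hcont hderiv
  have hrI : r ∈ Ioo a b := ⟨hs.1.trans_lt hr.1, hr.2.trans ht.2⟩
  have hMr := habove r ⟨hr.1, hr.2.le⟩
  have hslope : 1 / ψ (y r) * deriv y r ≤ 1 := by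
    rw [one_div, inv_mul_le_iff₀ (hψ _ (hM.trans hMr)), mul_one]
    exact hle r hrI hMr.le
  rw [hreq, div_le_one (sub_pos.2 hst), max_eq_left (habove t ⟨hst, le_rfl⟩).le,
    max_eq_right (mem_Iic.1 hsM)] at hslope
  have hFlt : F N < F (y t) := hmono hN (hN.trans hlt) hlt
  linarith [hs.1, ht.2]

/-- Every time after `t0` lies before the first impulse or between two consecutive ones. -/
lemma ImpulseSeq.mem_Ico {t0 : ℝ} {T : ℕ → ℝ} (hT : ImpulseSeq t0 T) {t : ℝ} (ht : t0 ≤ t) :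
    t ∈ Ico t0 (T 0) ∨ ∃ i, t ∈ Ico (T i) (T (i + 1)) := by
  have hex : ∃ n, t < T n := (hT.2.2.eventually_gt_atTop t).exists
  classical
  rcases h : Nat.find hex with _ | i
  · exact Or.inl ⟨ht, h ▸ Nat.find_spec hex⟩
  · refine Or.inr ⟨i, not_lt.1 (Nat.find_min hex (by omega)), h ▸ Nat.find_spec hex⟩

/-- Trajectories starting below a level `M ≥ χ(u)` with `M > 0` stay below the value `N` that
the flow `ẏ = ψ(y)` reaches from `M` in time `θ`. -/
lemma LyapTraj.le_of_dwell {t0 u θ M N : ℝ} {T ym : ℕ → ℝ} {ψ α χ F y : ℝ → ℝ}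
    (hy : LyapTraj t0 T u ψ α χ y ym) (hT : ImpulseSeq t0 T) (hT0 : T 0 - t0 ≤ θ)
    (hTi : ∀ i, T (i + 1) - T i ≤ θ) (hψ : ∀ s > (0:ℝ), 0 < ψ s) (hα : PosDef α)
    (hF : ∀ s > (0:ℝ), HasDerivAt F (1 / ψ s) s) (hmono : StrictMonoOn F (Ioi 0))
    (hdwell : ∀ a > (0:ℝ), F (α a) + θ ≤ F a) (hθ : 0 ≤ θ) (hM : 0 < M) (hN : 0 < N)
    (hFN : F N = F M + θ) (h0 : y t0 ≤ M) (hu : χ u ≤ M) :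
    ∀ t ≥ t0, y t ≤ N := by
  obtain ⟨hnn, hc0, hci, hlim, hd, hle, hjump⟩ := hy
  have ht0 : ∀ i, t0 < T i := fun i => hT.2.1.trans_le (hT.1.monotone (Nat.zero_le i))
  have hfirst : ∀ t ∈ Ico t0 (T 0), y t ≤ N := by
    have hne : ∀ t ∈ Ioo t0 (T 0), ∀ i, t ≠ T i := fun t ht i =>
      (ht.2.trans_le (hT.1.monotone (Nat.zero_le i))).ne
    exact le_of_deriv_le_of_antideriv hψ hF hmono hM hN hFN hθ hT0 hc0
      (fun t ht => hd t ht.1.le (hne t ht))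
      (fun t ht h => hle t ht.1.le (hne t ht) (hu.trans h)) h0
  have hnext : ∀ i, y (T i) ≤ M → ∀ t ∈ Ico (T i) (T (i + 1)), y t ≤ N := by
    intro i hi
    have hne : ∀ t ∈ Ioo (T i) (T (i + 1)), ∀ j, t ≠ T j := by
      rintro t ht j rfl
      have h₁ := hT.1.lt_iff_lt.1 ht.1
      have h₂ := hT.1.lt_iff_lt.1 ht.2
      omega
    exact le_of_deriv_le_of_antideriv hψ hF hmono hM hN hFN hθ (hTi i) (hci i)
      (fun t ht => hd t ((ht0 i).trans ht.1).le (hne t ht))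
      (fun t ht h => hle t ((ht0 i).trans ht.1).le (hne t ht) (hu.trans h)) hi
  have hafter : ∀ i s, t0 ≤ s → s < T i → (∀ t ∈ Ico s (T i), y t ≤ N) → y (T i) ≤ M := by
    intro i s hs hsi hbd
    have hev : ∀ᶠ t in 𝓝[<] T i, t ∈ Ico s (T i) := Ico_mem_nhdsLT hsi
    have hupper : ym i ≤ N := le_of_tendsto (hlim i) (hev.mono hbd)
    have hlower : 0 ≤ ym i :=
      ge_of_tendsto (hlim i) (hev.mono fun t ht => hnn t (hs.trans ht.1))
    refine (hjump i).trans (max_le ?_ hu)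
    rcases hlower.eq_or_lt with h | h
    · rw [← h, hα.2.1]
      exact hM.le
    · have h₁ := hdwell _ h
      have h₂ := hmono.monotoneOn (mem_Ioi.2 h) (mem_Ioi.2 hN) hupper
      exact (hmono.le_iff_le (mem_Ioi.2 (hα.2.2 _ h)) hM).1 (by linarith)
  have himpulse : ∀ i, y (T i) ≤ M := by
    intro i
    induction i with
    | zero => exact hafter 0 t0 le_rfl hT.2.1 hfirst
    | succ i ih => exact hafter _ (T i) (ht0 i).le (hT.1 i.lt_succ_self) (hnext i ih)
  intro t ht
  rcases hT.mem_Ico ht with h | ⟨i, h⟩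
  · exact hfirst t h
  · exact hnext i (himpulse i) t h

/-- A primitive `F` that is an increasing bijection from `(0,∞)` onto the reals conjugates the
translation by `θ` to a class `K∞` function. -/
lemma exists_classKinf_conj_add {F : ℝ → ℝ} (hmono : StrictMonoOn F (Ioi 0))
    (hsurj : ∀ z, ∃ x > 0, F x = z) (θ : ℝ) :
    ∃ G, ClassKinf G ∧ ∀ a > 0, 0 < G a ∧ F (G a) = F a + θ := by
  choose I hIpos hI using hsurj
  have hG : ∀ a > 0, (if a ≤ 0 then 0 else I (F a + θ)) = I (F a + θ) := fun a ha => by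
    simp [not_le.2 ha]
  refine ⟨fun a => if a ≤ 0 then 0 else I (F a + θ),
    classKinf_of_strictMonoOn_of_surjOn ?_ (by simp) ?_,
    fun a ha => by simp only [hG a ha]; exact ⟨hIpos _, hI _⟩⟩
  · intro a ha b hb hab
    have hb0 : 0 < b := (mem_Ici.1 ha).trans_lt hab
    simp only [hG b hb0]
    rcases (mem_Ici.1 ha).eq_or_lt with rfl | ha0
    · simpa using hIpos _
    · simp only [hG a ha0]
      refine (hmono.lt_iff_lt (hIpos _) (hIpos _)).1 ?_
      rw [hI, hI]
      linarith [hmono (mem_Ioi.2 ha0) (mem_Ioi.2 hb0) hab]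
  · intro z hz
    rcases (mem_Ici.1 hz).eq_or_lt with rfl | hz0
    · exact ⟨0, self_mem_Ici, by simp⟩
    · refine ⟨I (F z - θ), (hIpos _).le, ?_⟩
      refine (hG _ (hIpos _)).trans (hmono.injOn (hIpos _) hz0 ?_)
      rw [hI, hI, sub_add_cancel]

/-- If every positive level has a smaller level at `F`-distance at least `θ > 0`, and `F` is
unbounded above, then `F` maps `(0,∞)` onto the reals. -/
lemma exists_pos_eq_of_dwell {F α : ℝ → ℝ} {θ : ℝ} (hθ : 0 < θ)
    (hF : ContinuousOn F (Ioi 0)) (htop : Tendsto F atTop atTop) (hα : ∀ a > (0:ℝ), 0 < α a)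
    (hdwell : ∀ a > (0:ℝ), F (α a) + θ ≤ F a) (z : ℝ) : ∃ x > 0, F x = z := by
  have hdown : ∀ n : ℕ, ∃ a > 0, F a ≤ F 1 - n * θ := by
    intro n
    induction n with
    | zero => exact ⟨1, one_pos, by simp⟩
    | succ n ih =>
      obtain ⟨a, ha, hle⟩ := ih
      refine ⟨α a, hα a ha, ?_⟩
      push_cast
      linarith [hdwell a ha]
  obtain ⟨n, hn⟩ := exists_nat_ge ((F 1 - z) / θ)
  rw [div_le_iff₀ hθ] at hn
  obtain ⟨a, ha, hle⟩ := hdown n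
  obtain ⟨b, hb, hb0⟩ := ((htop.eventually_ge_atTop z).and (eventually_gt_atTop 0)).exists
  obtain ⟨x, hx, hxz⟩ := isPreconnected_Ioi.intermediate_value (mem_Ioi.2 ha) (mem_Ioi.2 hb0) hF
    ⟨by linarith, hb⟩
  exact ⟨x, hx, hxz⟩

/-- uniform global stability over the class `S̃_θ` under the
reversed fixed dwell-time condition `∫_{α(a)}^a ds/ψ(s) ≥ θ` (δ = 0); `ξ` and
`γ` are independent of the impulse time sequence. -/
theorem stmt_8 {X : Type*} [NormedAddCommGroup X]
    (t0 : ℝ) (ψ₁ ψ₂ : ℝ → ℝ) (hψ₁ : ClassKinf ψ₁) (hψ₂ : ClassKinf ψ₂)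
    (V : X → ℝ) (hVc : Continuous V) (hVnn : ∀ x, 0 ≤ V x)
    (hVlow : ∀ x : X, ψ₁ ‖x‖ ≤ V x) (hVup : ∀ x : X, V x ≤ ψ₂ ‖x‖)
    (ψ α : ℝ → ℝ) (hψ : PosDef ψ)
    (hψdiv : Filter.Tendsto (fun b => ∫ s in (1:ℝ)..b, 1 / ψ s)
      Filter.atTop Filter.atTop)
    (hα : PosDef α)
    (χ : ℝ → ℝ) (hχ : ClassKinf χ)
    (θ : ℝ) (hθ : 0 < θ)
    (hFDT : ∀ a > (0:ℝ), θ ≤ ∫ s in (α a)..a, 1 / ψ s) :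
    ∃ ξ γ : ℝ → ℝ, ClassKinf ξ ∧ ClassK γ ∧
      ∀ T : ℕ → ℝ, ImpulseSeq t0 T →
        T 0 - t0 ≤ θ → (∀ i, T (i+1) - T i ≤ θ) →
        ∀ u ≥ (0:ℝ), ∀ x : ℝ → X, ∀ ym : ℕ → ℝ,
          LyapTraj t0 T u (fun s => ψ s) α χ (fun t => V (x t)) ym →
          ∀ t ≥ t0, ‖x t‖ ≤ ξ ‖x t0‖ + γ u := by
  set F : ℝ → ℝ := fun b => ∫ s in (1:ℝ)..b, 1 / ψ s
  have hF : ∀ s > (0:ℝ), HasDerivAt F (1 / ψ s) s := fun s hs => hψ.hasDerivAt_integral_inv hs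
  have hFc : ContinuousOn F (Ioi 0) := fun s hs => (hF s hs).continuousAt.continuousWithinAt
  have hmono : StrictMonoOn F (Ioi 0) := by
    refine strictMonoOn_of_deriv_pos (convex_Ioi 0) hFc fun s hs => ?_
    rw [interior_Ioi] at hs
    rw [(hF s hs).deriv]
    exact one_div_pos.2 (hψ.2.2 s hs)
  have hdwell : ∀ a > (0:ℝ), F (α a) + θ ≤ F a := by
    intro a ha
    have hadd : F (α a) + ∫ s in (α a)..a, 1 / ψ s = F a :=
      integral_add_adjacent_intervals (hψ.intervalIntegrable_inv one_pos (hα.2.2 a ha))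
        (hψ.intervalIntegrable_inv (hα.2.2 a ha) ha)
    linarith [hFDT a ha]
  obtain ⟨G, hG, hGF⟩ := exists_classKinf_conj_add hmono
    (exists_pos_eq_of_dwell hθ hFc hψdiv hα.2.2 hdwell) θ
  obtain ⟨φ, hφ, hφinv⟩ := hψ₁.exists_inverse
  have hφG := hφ.comp hG
  refine ⟨(φ ∘ G) ∘ ψ₂, (φ ∘ G) ∘ χ, hφG.comp hψ₂, (hφG.comp hχ).1, ?_⟩
  intro T hT hT0 hTi u hu x ym hy t ht
  have hlevel : ∀ M > 0, V (x t0) ≤ M → χ u ≤ M → V (x t) ≤ G M := fun M hM h0 hχM =>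
    hy.le_of_dwell hT hT0 hTi hψ.2.2 hα hF hmono hdwell hθ.le hM (hGF M hM).1 (hGF M hM).2
      h0 hχM t ht
  have hψ₂nn := hψ₂.1.nonneg (norm_nonneg (x t0))
  have hχnn := hχ.1.nonneg hu
  have hbound : V (x t) ≤ G (max (ψ₂ ‖x t0‖) (χ u)) := by
    have h0 : V (x t0) ≤ max (ψ₂ ‖x t0‖) (χ u) := (hVup _).trans (le_max_left _ _)
    have hχM := le_max_right (ψ₂ ‖x t0‖) (χ u)
    rcases (hψ₂nn.trans (le_max_left _ (χ u))).eq_or_lt with h | h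
    · rw [← h] at h0 hχM ⊢
      rw [hG.1.2.2]
      by_contra! hpos
      obtain ⟨ε, hε, hεG⟩ := hG.surjOn (mem_Ici.2 (half_pos hpos).le)
      have hε0 : 0 < ε := (mem_Ici.1 hε).lt_of_ne fun he => by
        rw [← he, hG.1.2.2] at hεG
        linarith
      have := hlevel ε hε0 (h0.trans hε0.le) (hχM.trans hε0.le)
      linarith
    · exact hlevel _ h h0 hχM
  calc ‖x t‖ = φ (ψ₁ ‖x t‖) := (hφinv _ (norm_nonneg _)).symm
    _ ≤ φ (G (max (ψ₂ ‖x t0‖) (χ u))) :=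
      hφ.1.2.1.monotoneOn (mem_Ici.2 (hψ₁.1.nonneg (norm_nonneg _)))
        (mem_Ici.2 (hG.1.nonneg (hψ₂nn.trans (le_max_left _ _)))) ((hVlow _).trans hbound)
    _ ≤ ((φ ∘ G) ∘ ψ₂) ‖x t0‖ + ((φ ∘ G) ∘ χ) u := hφG.map_max_le_add hψ₂nn hχnn
end

section
/- Fix t₀ ∈ ℝ and a Banach space X. Let ψ₁, ψ₂ ∈ K∞ and V : X → [0,∞) be continuous with ψ₁(‖x‖) ≤ V(x) ≤ ψ₂(‖x‖) for all x ∈ X. Let c ∈ ℝ, d ≠ 0, χ ∈ K∞, and let h : [0,∞) → (0,∞) be such that there exists g of class L with h(x) ≤ g(x) for all x ≥ 0. Let S[h] be the set of impulse time sequences T with −d·N_T(t,s) − c·(t−s) ≤ ln h(t−s) for all t ≥ s ≥ t₀, where N_T(t,s) is the number of indices i with s < t_i ≤ t. Then there exist β of class KL and γ of class K, independent of the choice of T ∈ S[h], such that for every T ∈ S[h], every u ≥ 0 and every x : [t₀,∞) → X for which y := V∘x is a (T,u)-Lyapunov trajectory for (ω, α, χ) with ω(s) = −c·s and α(s) = e^{−d}·s,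 one has ‖x(t)‖ ≤ β(‖x(t₀)‖, t − t₀) + γ(u) for all t ≥ t₀ (uniform ISS over S[h]). -/
open Set Filter Topology intervalIntegral

/-- `Ncount T s t` is the number of impulse times `T i` lying in `(s, t]`. -/
noncomputable def Ncount (T : ℕ → ℝ) (s t : ℝ) : ℕ :=
  Set.ncard {i : ℕ | s < T i ∧ T i ≤ t}

/-- A class `K∞` function has an inverse on `[0,∞)`, extended to an order isomorphism of `ℝ`. -/
theorem ClassKinf.exists_orderIso {ψ : ℝ → ℝ} (hψ : ClassKinf ψ) :
    ∃ e : ℝ ≃o ℝ, ∀ r ≥ 0, e r = ψ r := by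
  obtain ⟨⟨hc, hm, h0⟩, htop⟩ := hψ
  let f : ℝ → ℝ := fun r => ψ (max r 0) + min r 0
  have hf : ∀ r ≥ 0, f r = ψ r := fun r hr => by simp [f, hr]
  have hfc : Continuous f :=
    (hc.comp_continuous (by fun_prop) fun r => le_max_right r 0).add (by fun_prop)
  have hfm : StrictMono f := by
    intro a b hab
    rcases lt_or_ge a 0 with ha | ha
    · have h1 : ψ (max a 0) ≤ ψ (max b 0) :=
        hm.monotoneOn (le_max_right a 0) (le_max_right b 0) (max_le_max_right 0 hab.le)
      have h2 : min a 0 < min b 0 := by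
        rw [min_eq_left ha.le]; exact lt_min hab ha
      exact add_lt_add_of_le_of_lt h1 h2
    · rw [hf a ha, hf b (le_trans ha hab.le)]
      exact hm ha (le_trans ha hab.le) hab
  have hftop : Tendsto f atTop atTop :=
    htop.congr' (by filter_upwards [eventually_ge_atTop 0] with r hr using (hf r hr).symm)
  have hfbot : Tendsto f atBot atBot :=
    tendsto_id.congr' (by
      filter_upwards [eventually_le_atBot 0] with r hr
      simp [f, hr, h0])
  exact ⟨hfm.orderIsoOfSurjective f (hfc.surjective hftop hfbot), hf⟩

theorem ClassKinf.classK_comp_orderIso_symm {ψ φ : ℝ → ℝ} (hψ : ClassKinf ψ) {e : ℝ ≃o ℝ}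
    (he : ∀ r ≥ 0, e r = ψ r) (hφ : ClassK φ) : ClassK fun r => e.symm (φ r) := by
  refine ⟨e.symm.continuous.comp_continuousOn hφ.1,
    e.symm.strictMono.comp_strictMonoOn hφ.2.1, ?_⟩
  change e.symm (φ 0) = 0
  rw [hφ.2.2, OrderIso.symm_apply_eq, he 0 le_rfl, hψ.1.2.2]

theorem ClassK.const_mul {φ : ℝ → ℝ} (hφ : ClassK φ) {C : ℝ} (hC : 0 < C) :
    ClassK fun r => C * φ r :=
  ⟨continuousOn_const.mul hφ.1,
    fun _ ha _ hb hab => mul_lt_mul_of_pos_left (hφ.2.1 ha hb hab) hC, by simp [hφ.2.2]⟩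

theorem ClassK.nonneg_s10 {φ : ℝ → ℝ} (hφ : ClassK φ) {r : ℝ} (hr : 0 ≤ r) : 0 ≤ φ r :=
  hφ.2.2 ▸ hφ.2.1.monotoneOn self_mem_Ici hr hr

theorem ClassK.pos {φ : ℝ → ℝ} (hφ : ClassK φ) {r : ℝ} (hr : 0 < r) : 0 < φ r :=
  hφ.2.2 ▸ hφ.2.1 self_mem_Ici hr.le hr

/-- The function `(r, t) ↦ ψ₁⁻¹ (g t * ψ₂ r)` is of class `KL`. -/
theorem classKL_orderIso_symm {ψ₁ ψ₂ g : ℝ → ℝ} (hψ₁ : ClassKinf ψ₁) (hψ₂ : ClassK ψ₂)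
    (hg : ClassL g) (hgpos : ∀ t ≥ 0, 0 < g t) {e : ℝ ≃o ℝ} (he : ∀ r ≥ 0, e r = ψ₁ r) :
    ClassKL fun r t => e.symm (g t * ψ₂ r) := by
  refine ⟨e.symm.continuous.comp_continuousOn ?_, fun t ht => ?_, fun r hr => ⟨?_, ?_, ?_⟩⟩
  · exact (hg.1.comp continuousOn_snd fun p hp => hp.2).mul
      (hψ₂.1.comp continuousOn_fst fun p hp => hp.1)
  · exact hψ₁.classK_comp_orderIso_symm he (hψ₂.const_mul (hgpos t ht))
  · exact e.symm.continuous.comp_continuousOn (hg.1.mul continuousOn_const)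
  · intro s hs t ht hst
    exact e.symm.strictMono (mul_lt_mul_of_pos_right (hg.2.1 hs ht hst) (hψ₂.pos hr))
  · have h0 : e.symm (0 * ψ₂ r) = 0 := by
      rw [zero_mul, OrderIso.symm_apply_eq, he 0 le_rfl, hψ₁.1.2.2]
    have := (e.symm.continuous.tendsto _).comp (hg.2.2.mul_const (ψ₂ r))
    rwa [h0] at this

theorem ImpulseSeq.finite_impulses {t0 : ℝ} {T : ℕ → ℝ} (hT : ImpulseSeq t0 T) (a b : ℝ) :
    {i : ℕ | a < T i ∧ T i ≤ b}.Finite := by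
  obtain ⟨n, hn⟩ := (hT.2.2.eventually_gt_atTop b).exists
  refine (Set.finite_Iio n).subset fun i hi => ?_
  by_contra hni
  exact (hn.trans_le (hT.1.monotone (not_lt.1 hni))).not_ge hi.2

/-- Splitting off the first impulse time after `a`. -/
theorem ImpulseSeq.exists_first_impulse {t0 : ℝ} {T : ℕ → ℝ} (hT : ImpulseSeq t0 T) {a b : ℝ}
    {n : ℕ} (hn : Ncount T a b = n + 1) :
    ∃ i, a < T i ∧ T i ≤ b ∧ (∀ j, a < T j → T i ≤ T j) ∧ Ncount T (T i) b = n := by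
  classical
  have hne : {i : ℕ | a < T i ∧ T i ≤ b}.Nonempty :=
    Set.nonempty_of_ncard_ne_zero (by unfold Ncount at hn; omega)
  obtain ⟨k, hk⟩ := hne
  have hex : ∃ i, a < T i := ⟨k, hk.1⟩
  have hmin : ∀ j, a < T j → T (Nat.find hex) ≤ T j := fun j hj =>
    hT.1.monotone (Nat.find_min' hex hj)
  have hfirst := Nat.find_spec hex
  generalize Nat.find hex = i at hmin hfirst
  have hib : T i ≤ b := (hmin k hk.1).trans hk.2
  refine ⟨i, hfirst, hib, hmin, ?_⟩
  have hset : {j : ℕ | a < T j ∧ T j ≤ b} = insert i {j : ℕ | T i < T j ∧ T j ≤ b} := by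
    ext j
    simp only [Set.mem_insert_iff, Set.mem_ofPred_eq]
    constructor
    · rintro ⟨h1, h2⟩
      rcases (hmin j h1).eq_or_lt with h | h
      · exact Or.inl (hT.1.injective h.symm)
      · exact Or.inr ⟨h, h2⟩
    · rintro (rfl | ⟨h1, h2⟩)
      · exact ⟨hfirst, hib⟩
      · exact ⟨hfirst.trans h1, h2⟩
  unfold Ncount at hn ⊢
  rw [hset, Set.ncard_insert_of_notMem (by simp) (hT.finite_impulses _ _)] at hn
  omega

theorem ImpulseSeq.no_impulse_of_ncount_eq_zero {t0 : ℝ} {T : ℕ → ℝ} (hT : ImpulseSeq t0 T)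
    {a b : ℝ} (hn : Ncount T a b = 0) (i : ℕ) (hi : a < T i) : b < T i := by
  by_contra! hb
  have := (Set.ncard_eq_zero (hT.finite_impulses a b)).1 hn
  exact (Set.ext_iff.1 this i).1 ⟨hi, hb⟩

namespace LyapTraj

variable {t0 c d u : ℝ} {T : ℕ → ℝ} {ω α χ y : ℝ → ℝ} {ym : ℕ → ℝ}

theorem continuousWithinAt_Ici (hT : ImpulseSeq t0 T) (hy : LyapTraj t0 T u ω α χ y ym)
    {a : ℝ} (ha : t0 ≤ a) : ContinuousWithinAt y (Ici a) a := by
  by_cases h : ∃ i, a = T i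
  · obtain ⟨i, rfl⟩ := h
    have hi : T i < T (i + 1) := hT.1 (Nat.lt_succ_self i)
    exact (hy.2.2.1 i (T i) ⟨le_rfl, hi⟩).mono_of_mem_nhdsWithin
      (Ico_mem_nhdsGE hi)
  · push Not at h
    exact (hy.2.2.2.2.1 a ha h).continuousAt.continuousWithinAt

/-- Exponential decay between impulses while the trajectory stays above `χ u`. -/
theorem le_exp_of_no_impulse (hT : ImpulseSeq t0 T)
    (hy : LyapTraj t0 T u (fun s => -c * s) α χ y ym) {a b : ℝ} (ha : t0 ≤ a) (hab : a ≤ b)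
    (hno : ∀ i, a < T i → b < T i) (habove : ∀ s ∈ Ioc a b, χ u < y s) :
    y b ≤ Real.exp (-c * (b - a)) * y a := by
  have hni : ∀ s ∈ Ioc a b, ∀ i, s ≠ T i := by
    rintro s hs i rfl
    exact (hno i hs.1).not_ge hs.2
  have hdiff : ∀ s ∈ Ioc a b, DifferentiableAt ℝ y s := fun s hs =>
    hy.2.2.2.2.1 s (ha.trans hs.1.le) (hni s hs)
  have hcont : ContinuousOn y (Icc a b) := by
    intro s hs
    rcases hs.1.eq_or_lt with rfl | h
    · exact (hy.continuousWithinAt_Ici hT ha).mono Icc_subset_Ici_self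
    · exact (hdiff s ⟨h, hs.2⟩).continuousAt.continuousWithinAt
  have hderiv : ∀ s ∈ Ioc a b, HasDerivAt (fun s => Real.exp (c * s) * y s)
      (Real.exp (c * s) * (c * 1) * y s + Real.exp (c * s) * deriv y s) s := fun s hs =>
    (((hasDerivAt_id s).const_mul c).exp).mul (hdiff s hs).hasDerivAt
  have hanti : AntitoneOn (fun s => Real.exp (c * s) * y s) (Icc a b) := by
    refine antitoneOn_of_deriv_nonpos (convex_Icc a b)
      (ContinuousOn.mul (by fun_prop) hcont) ?_ ?_ <;> rw [interior_Icc]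
    · exact fun s hs =>
        (hderiv s (Ioo_subset_Ioc_self hs)).differentiableAt.differentiableWithinAt
    · intro s hs
      have hs' := Ioo_subset_Ioc_self hs
      rw [(hderiv s hs').deriv]
      have h1 : deriv y s ≤ -c * y s :=
        hy.2.2.2.2.2.1 s (ha.trans hs.1.le) (hni s hs') (habove s hs').le
      nlinarith [Real.exp_pos (c * s)]
  have hle : Real.exp (c * b) * y b ≤ Real.exp (c * a) * y a :=
    hanti (left_mem_Icc.2 hab) (right_mem_Icc.2 hab) hab
  have hexp : Real.exp (-c * (b - a)) = Real.exp (-(c * b)) * Real.exp (c * a) := by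
    rw [← Real.exp_add]; ring_nf
  calc y b = Real.exp (-(c * b)) * (Real.exp (c * b) * y b) := by
        rw [← mul_assoc, ← Real.exp_add]; simp
    _ ≤ Real.exp (-(c * b)) * (Real.exp (c * a) * y a) := by gcongr
    _ = _ := by rw [hexp]; ring

/-- Exponential estimate up to and including the first impulse time after `a`. -/
theorem le_exp_of_first_impulse (hT : ImpulseSeq t0 T)
    (hy : LyapTraj t0 T u (fun s => -c * s) (fun s => Real.exp (-d) * s) χ y ym)
    {a : ℝ} {i : ℕ} (ha : t0 ≤ a) (hai : a < T i) (hfirst : ∀ j, a < T j → T i ≤ T j)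
    (habove : ∀ s ∈ Ioc a (T i), χ u < y s) :
    y (T i) ≤ Real.exp (-d - c * (T i - a)) * y a := by
  have hym : ym i ≤ Real.exp (-c * (T i - a)) * y a := by
    have hlim : Tendsto (fun s => Real.exp (-c * (s - a)) * y a) (𝓝[<] (T i))
        (𝓝 (Real.exp (-c * (T i - a)) * y a)) :=
      (Continuous.tendsto (by fun_prop) (T i)).mono_left nhdsWithin_le_nhds
    refine le_of_tendsto_of_tendsto (hy.2.2.2.1 i) hlim ?_
    filter_upwards [Ioo_mem_nhdsLT hai] with s hs
    exact hy.le_exp_of_no_impulse hT ha hs.1.le (fun j hj => hs.2.trans_le (hfirst j hj))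
      fun r hr => habove r ⟨hr.1, hr.2.trans hs.2.le⟩
  have hjump : y (T i) ≤ Real.exp (-d) * ym i :=
    (le_max_iff.1 (hy.2.2.2.2.2.2 i)).resolve_right (habove _ ⟨hai, le_rfl⟩).not_ge
  calc y (T i) ≤ Real.exp (-d) * (Real.exp (-c * (T i - a)) * y a) :=
        hjump.trans (by gcongr)
    _ = _ := by rw [← mul_assoc, ← Real.exp_add]; ring_nf

/-- Exponential estimate across impulses while the trajectory stays above `χ u`. -/
theorem le_exp_ncount (hT : ImpulseSeq t0 T)
    (hy : LyapTraj t0 T u (fun s => -c * s) (fun s => Real.exp (-d) * s) χ y ym)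
    {a b : ℝ} (ha : t0 ≤ a) (hab : a ≤ b) (habove : ∀ s ∈ Ioc a b, χ u < y s) :
    y b ≤ Real.exp (-d * (Ncount T a b : ℝ) - c * (b - a)) * y a := by
  induction hn : Ncount T a b generalizing a with
  | zero =>
    simpa using hy.le_exp_of_no_impulse hT ha hab (hT.no_impulse_of_ncount_eq_zero hn) habove
  | succ n ih =>
    obtain ⟨i, hai, hib, hfirst, hcount⟩ := hT.exists_first_impulse hn
    have h1 := hy.le_exp_of_first_impulse hT ha hai hfirst
      fun s hs => habove s ⟨hs.1, hs.2.trans hib⟩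
    have h2 := ih (ha.trans hai.le) hib (fun s hs => habove s ⟨hai.trans hs.1, hs.2⟩) hcount
    refine h2.trans ((mul_le_mul_of_nonneg_left h1 (Real.exp_pos _).le).trans_eq ?_)
    rw [← mul_assoc, ← Real.exp_add]
    push_cast
    ring_nf

/-- Either the trajectory has stayed above `χ u` up to time `t`, or there is a time `a` with
`y a` bounded in terms of `χ u` after which it stays above `χ u`. -/
theorem above_or_exists_last_time (hy : LyapTraj t0 T u ω (fun s => Real.exp (-d) * s) χ y ym)
    (hχu : 0 ≤ χ u) (t : ℝ) :
    (∀ s ∈ Icc t0 t, χ u < y s) ∨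
      ∃ a ∈ Icc t0 t, y a ≤ max 1 (Real.exp (-d)) * χ u ∧ ∀ s ∈ Ioc a t, χ u < y s := by
  let A : Set ℝ := {s ∈ Icc t0 t | y s ≤ χ u}
  rcases A.eq_empty_or_nonempty with hA | hA
  · refine Or.inl fun s hs => ?_
    by_contra! h
    exact (Set.ext_iff.1 hA s).1 ⟨hs, h⟩
  right
  have hbdd : BddAbove A := ⟨t, fun s hs => hs.1.2⟩
  have hlub : IsLUB A (sSup A) := isLUB_csSup hA hbdd
  generalize sSup A = a at hlub
  have hat : a ≤ t := hlub.2 fun s hs => hs.1.2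
  have hta : t0 ≤ a := by
    obtain ⟨s, hs⟩ := hA
    exact hs.1.1.trans (hlub.1 hs)
  refine ⟨a, ⟨hta, hat⟩, ?_, fun s hs => ?_⟩
  · have hmul : χ u ≤ max 1 (Real.exp (-d)) * χ u :=
      le_mul_of_one_le_left hχu (le_max_left _ _)
    by_cases hya : y a ≤ χ u
    · exact hya.trans hmul
    have hfreq : ∃ᶠ s in 𝓝[<] a, y s ≤ χ u := by
      have h1 := hlub.frequently_mem hA
      rw [← Iio_insert, nhdsWithin_insert, frequently_sup, frequently_pure] at h1
      exact (h1.resolve_left fun h => hya h.2).mono fun s hs => hs.2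
    by_cases himp : ∃ i, a = T i
    · obtain ⟨i, rfl⟩ := himp
      have hym : ym i ≤ χ u := le_of_tendsto_of_frequently (hy.2.2.2.1 i) hfreq
      refine (hy.2.2.2.2.2.2 i).trans (max_le ?_ hmul)
      exact (mul_le_mul_of_nonneg_left hym (Real.exp_pos _).le).trans
        (mul_le_mul_of_nonneg_right (le_max_right _ _) hχu)
    · push Not at himp
      have hc : ContinuousAt y a := (hy.2.2.2.2.1 a hta himp).continuousAt
      exact absurd (le_of_tendsto_of_frequently (hc.mono_left nhdsWithin_le_nhds) hfreq) hya
  · by_contra! h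
    exact hs.1.not_ge (hlub.1 ⟨⟨hta.trans hs.1.le, hs.2⟩, h⟩)

end LyapTraj

/-- uniform ISS over the class `S[h]` of impulse time sequences
satisfying the generalized average dwell-time condition
`-d·N(t,s) - c·(t-s) ≤ ln h(t-s)`, for systems with an exponential
ISS-Lyapunov function with rate coefficients `c`, `d ≠ 0`; `β` and `γ` are
independent of the choice of `T ∈ S[h]`. -/
theorem stmt_10 {X : Type*} [NormedAddCommGroup X]
    (t0 : ℝ) (ψ₁ ψ₂ : ℝ → ℝ) (hψ₁ : ClassKinf ψ₁) (hψ₂ : ClassKinf ψ₂)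
    (V : X → ℝ) (hVc : Continuous V) (hVnn : ∀ x, 0 ≤ V x)
    (hVlow : ∀ x : X, ψ₁ ‖x‖ ≤ V x) (hVup : ∀ x : X, V x ≤ ψ₂ ‖x‖)
    (c d : ℝ) (hd : d ≠ 0)
    (χ : ℝ → ℝ) (hχ : ClassKinf χ)
    (h g : ℝ → ℝ) (hhpos : ∀ x ≥ (0:ℝ), 0 < h x) (hg : ClassL g)
    (hhg : ∀ x ≥ (0:ℝ), h x ≤ g x) :
    ∃ β : ℝ → ℝ → ℝ, ∃ γ : ℝ → ℝ, ClassKL β ∧ ClassK γ ∧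
      ∀ T : ℕ → ℝ, ImpulseSeq t0 T →
        (∀ s t : ℝ, t0 ≤ s → s ≤ t →
          -d * (Ncount T s t : ℝ) - c * (t - s) ≤ Real.log (h (t - s))) →
        ∀ u ≥ (0:ℝ), ∀ x : ℝ → X, ∀ ym : ℕ → ℝ,
          LyapTraj t0 T u (fun s => -c * s) (fun s => Real.exp (-d) * s) χ
            (fun t => V (x t)) ym →
          ∀ t ≥ t0, ‖x t‖ ≤ β ‖x t0‖ (t - t0) + γ u := by
  have hgpos : ∀ t ≥ 0, 0 < g t := fun t ht => (hhpos t ht).trans_le (hhg t ht)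
  obtain ⟨e, he⟩ := hψ₁.exists_orderIso
  have hCpos : 0 < g 0 * max 1 (Real.exp (-d)) :=
    mul_pos (hgpos 0 le_rfl) (zero_lt_one.trans_le (le_max_left _ _))
  have hβ := classKL_orderIso_symm hψ₁ hψ₂.1 hg hgpos he
  have hγ := hψ₁.classK_comp_orderIso_symm he (hχ.1.const_mul hCpos)
  refine ⟨_, _, hβ, hγ, fun T hT hdwell u hu x ym hy t ht => ?_⟩
  have hnorm : ∀ {v : ℝ}, V (x t) ≤ v → ‖x t‖ ≤ e.symm v := fun hv => by
    rw [OrderIso.le_symm_apply, he _ (norm_nonneg _)]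
    exact (hVlow _).trans hv
  have hexp : ∀ s ∈ Icc t0 t,
      Real.exp (-d * (Ncount T s t : ℝ) - c * (t - s)) ≤ g (t - s) := fun s hs => by
    have hts : 0 ≤ t - s := sub_nonneg.2 hs.2
    calc _ ≤ Real.exp (Real.log (h (t - s))) := Real.exp_le_exp.2 (hdwell s t hs.1 hs.2)
      _ = h (t - s) := Real.exp_log (hhpos _ hts)
      _ ≤ g (t - s) := hhg _ hts
  have hχu : 0 ≤ χ u := hχ.1.nonneg_s10 hu
  rcases hy.above_or_exists_last_time hχu t with habove | ⟨a, ha, hya, habove⟩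
  · have h1 := hy.le_exp_ncount hT le_rfl ht fun s hs => habove s ⟨hs.1.le, hs.2⟩
    have h2 : V (x t) ≤ g (t - t0) * ψ₂ ‖x t0‖ :=
      h1.trans (mul_le_mul (hexp t0 ⟨le_rfl, ht⟩) (hVup _) (hVnn _)
        (hgpos _ (sub_nonneg.2 ht)).le)
    exact (hnorm h2).trans (le_add_of_nonneg_right (hγ.nonneg_s10 hu))
  · have h1 := hy.le_exp_ncount hT ha.1 ha.2 habove
    have hts : 0 ≤ t - a := sub_nonneg.2 ha.2
    have h2 : V (x t) ≤ g 0 * max 1 (Real.exp (-d)) * χ u := by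
      rw [mul_assoc]
      exact h1.trans (mul_le_mul
        ((hexp a ha).trans (hg.2.1.antitoneOn self_mem_Ici hts hts)) hya (hVnn _)
        (hgpos 0 le_rfl).le)
    exact (hnorm h2).trans (le_add_of_nonneg_left
      ((hβ.2.1 _ (sub_nonneg.2 ht)).nonneg_s10 (norm_nonneg _)))
end
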